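/- Let N > 1 and let L be a positive integer with L ≤ √N / 10. Define f_N(x) = −ln((1+x)/2 + (1−x)/(2N)) for x ∈ [−1,1], Δ_L(x) = √(1−x²)/L + 1/L², and τ_1(f_N, Δ_L) = sup{ |f_N(x) − f_N(y)| : x, y ∈ [−1,1], |x − y| ≤ Δ_L(x) }. Then ln(N/(2L²)) ≤ τ_1(f_N, Δ_L) ≤ ln(2N/L²). -/

import Mathlib

/-- `f_N(x) = -ln((1+x)/2 + (1-x)/(2N))` on `[-1,1]`. -/
noncomputable def fN (N x : ℝ) : ℝ := -Real.log ((1 + x) / 2 + (1 - x) / (2 * N))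

/-- `Δ_L(x) = √(1-x²)/L + 1/L²`. -/
noncomputable def deltaL (L : ℕ) (x : ℝ) : ℝ :=
  Real.sqrt (1 - x ^ 2) / L + 1 / (L : ℝ) ^ 2

/-- The first-order modulus of continuity
`τ₁(f, Δ_L) = sup{ |f(x) − f(y)| : x, y ∈ [−1,1], |x − y| ≤ Δ_L(x) }`. -/
noncomputable def tau1 (f : ℝ → ℝ) (L : ℕ) : ℝ :=
  sSup { d | ∃ x ∈ Set.Icc (-1 : ℝ) 1, ∃ y ∈ Set.Icc (-1 : ℝ) 1,
    |x - y| ≤ deltaL L x ∧ d = |f x - f y| }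

/-- The argument of the logarithm in `fN` is positive on `[-1, 1]`. -/
lemma fN_arg_pos {N x : ℝ} (hN : 1 < N) (hx : x ∈ Set.Icc (-1 : ℝ) 1) :
    0 < (1 + x) / 2 + (1 - x) / (2 * N) := by
  obtain ⟨h1, h2⟩ := hx
  have h : (1 + x) / 2 + (1 - x) / (2 * N) = ((1 + x) * N + (1 - x)) / (2 * N) := by
    field_simp
  rw [h]
  apply div_pos <;> nlinarith

lemma deltaL_nonneg (L : ℕ) (x : ℝ) : 0 ≤ deltaL L x := by
  unfold deltaL
  positivity

/-- Young's inequality for `√(1 - x²) / L`, measured from the endpoint `-1`. -/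
lemma deltaL_le {L : ℕ} {x : ℝ} (hx : x ∈ Set.Icc (-1 : ℝ) 1) :
    deltaL L x ≤ (1 + x) / 3 + 5 / 2 * (1 / (L : ℝ) ^ 2) := by
  obtain ⟨h1, h2⟩ := hx
  have hs : Real.sqrt (1 - x ^ 2) ^ 2 = 1 - x ^ 2 := Real.sq_sqrt (by nlinarith)
  have hs0 := Real.sqrt_nonneg (1 - x ^ 2)
  have ht : 0 ≤ 1 / (L : ℝ) := by positivity
  have e : 1 / (L : ℝ) ^ 2 = (1 / (L : ℝ)) ^ 2 := by rw [div_pow, one_pow]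
  unfold deltaL
  rw [e, div_eq_mul_one_div (Real.sqrt _)]
  generalize Real.sqrt (1 - x ^ 2) = s at *
  generalize 1 / (L : ℝ) = t at *
  nlinarith [sq_nonneg (s - 3 * t)]

/-- If `1 + x` and `1 + y` are comparable up to `O(1 / L²)`, the increment of `fN` is controlled. -/
lemma fN_sub_le {N x y r : ℝ} (hN : 1 < N) (hr : 0 ≤ r) (hNr : 100 ≤ N * r)
    (hx : x ∈ Set.Icc (-1 : ℝ) 1) (hy : y ∈ Set.Icc (-1 : ℝ) 1)
    (h : 1 + y ≤ 3 / 2 * (1 + x) + 15 / 4 * r) :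
    fN N x - fN N y ≤ Real.log (2 * (N * r)) := by
  have gx := fN_arg_pos hN hx
  have gy := fN_arg_pos hN hy
  have key : (1 + y) / 2 + (1 - y) / (2 * N) ≤
      2 * (N * r) * ((1 + x) / 2 + (1 - x) / (2 * N)) := by
    have e (z : ℝ) : (1 + z) / 2 + (1 - z) / (2 * N) = (1 + (N - 1) / 2 * (1 + z)) / N := by
      field_simp
      ring
    rw [e, e, ← mul_div_assoc]
    gcongr
    have hM : 0 < (N - 1) / 2 := by linarith
    have h1 := mul_le_mul_of_nonneg_left h hM.le
    have h2 : 0 ≤ (N - 1) / 2 * (1 + x) := mul_nonneg hM.le (by linarith [hx.1])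
    have h3 := mul_le_mul_of_nonneg_right hNr h2
    nlinarith
  have h1 := Real.log_le_log gy key
  rw [Real.log_mul (by positivity) gx.ne'] at h1
  unfold fN
  linarith

/-- Every increment entering `tau1 (fN N) L` is at most `log (2 N / L²)`. -/
lemma abs_fN_sub_le {N x y : ℝ} {L : ℕ} (hN : 1 < N) (hNr : 100 ≤ N * (1 / (L : ℝ) ^ 2))
    (hx : x ∈ Set.Icc (-1 : ℝ) 1) (hy : y ∈ Set.Icc (-1 : ℝ) 1) (h : |x - y| ≤ deltaL L x) :
    |fN N x - fN N y| ≤ Real.log (2 * N / (L : ℝ) ^ 2) := by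
  have hr : 0 ≤ 1 / (L : ℝ) ^ 2 := by positivity
  have e : 2 * N / (L : ℝ) ^ 2 = 2 * (N * (1 / (L : ℝ) ^ 2)) := by ring
  obtain ⟨h1, h2⟩ := abs_le.1 (h.trans (deltaL_le hx))
  rw [e, abs_sub_le_iff]
  exact ⟨fN_sub_le hN hr hNr hx hy (by linarith [hx.1]),
    fN_sub_le hN hr hNr hy hx (by linarith [hx.1])⟩

theorem tau1_fN_bounds (N : ℝ) (hN : 1 < N) (L : ℕ) (hL : 0 < L)
    (hLN : (L : ℝ) ≤ Real.sqrt N / 10) :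
    Real.log (N / (2 * (L : ℝ) ^ 2)) ≤ tau1 (fN N) L ∧
      tau1 (fN N) L ≤ Real.log (2 * N / (L : ℝ) ^ 2) := by
  have hL1 : (1 : ℝ) ≤ L := by exact_mod_cast hL
  have hL2 : (1 : ℝ) ≤ (L : ℝ) ^ 2 := one_le_pow₀ hL1
  have hsq : 100 * (L : ℝ) ^ 2 ≤ N := by
    have h := Real.sq_sqrt (zero_le_one.trans hN.le)
    nlinarith
  have hNr : 100 ≤ N * (1 / (L : ℝ) ^ 2) := by
    rw [mul_one_div, le_div_iff₀ (by positivity)]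
    exact hsq
  have hm1 : (-1 : ℝ) ∈ Set.Icc (-1 : ℝ) 1 := by norm_num
  have hub : ∀ d ∈ { d | ∃ x ∈ Set.Icc (-1 : ℝ) 1, ∃ y ∈ Set.Icc (-1 : ℝ) 1,
      |x - y| ≤ deltaL L x ∧ d = |fN N x - fN N y| }, d ≤ Real.log (2 * N / (L : ℝ) ^ 2) := by
    rintro d ⟨x, hx, y, hy, hxy, rfl⟩
    exact abs_fN_sub_le hN hNr hx hy hxy
  constructor
  · have hr0 : 0 < 1 / (L : ℝ) ^ 2 := by positivity
    have hr1 : 1 / (L : ℝ) ^ 2 ≤ 1 := by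
      rw [div_le_one (by positivity)]
      exact hL2
    have hy : -1 + 1 / (L : ℝ) ^ 2 ∈ Set.Icc (-1 : ℝ) 1 := ⟨by linarith, by linarith⟩
    have hd : |-1 - (-1 + 1 / (L : ℝ) ^ 2)| ≤ deltaL L (-1) := by
      have e : -1 - (-1 + 1 / (L : ℝ) ^ 2) = -(1 / (L : ℝ) ^ 2) := by ring
      rw [e, abs_neg, abs_of_pos hr0]
      simp [deltaL]
    refine le_trans ?_ (le_csSup ⟨_, hub⟩ ⟨-1, hm1, _, hy, hd, rfl⟩)
    refine le_trans ?_ (le_abs_self _)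
    have g1 := fN_arg_pos hN hm1
    have g2 := fN_arg_pos hN hy
    have key : N / (2 * (L : ℝ) ^ 2) * ((1 + -1) / 2 + (1 - -1) / (2 * N)) ≤
        (1 + (-1 + 1 / (L : ℝ) ^ 2)) / 2 + (1 - (-1 + 1 / (L : ℝ) ^ 2)) / (2 * N) := by
      have e : N / (2 * (L : ℝ) ^ 2) * ((1 + -1) / 2 + (1 - -1) / (2 * N)) =
          (1 + (-1 + 1 / (L : ℝ) ^ 2)) / 2 := by
        field_simp
        ring
      rw [e]
      exact le_add_of_nonneg_right (div_nonneg (by linarith) (by linarith))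
    have hq : 0 < N / (2 * (L : ℝ) ^ 2) := by positivity
    have h := Real.log_le_log (mul_pos hq g1) key
    rw [Real.log_mul hq.ne' g1.ne'] at h
    unfold fN
    linarith
  · exact csSup_le ⟨_, -1, hm1, -1, hm1, by simpa using deltaL_nonneg L (-1), rfl⟩ hub
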